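/- arXiv:0707.0718 — 2 statements merged into one kernel-verified Lean document; each statement's English description precedes it below -/
import Mathlib

section
/- Let N ≥ 1 be an integer, set N' := lcm(3,N), and let l be a positive divisor of N' such that N'/l is squarefree. Let M be the finite quadratic module with underlying group ℤ/2l × ℤ/2N × ℤ/3 and quadratic form Q(x,y,z) := (−x²/4l − y²/4N − z²/3) mod ℤ. Then Inv(M) = 0, i.e. the only function λ : M → ℂ with T_M λ = λ and S_M λ = λ is λ = 0. (This is the representation-theoretic content of the theorem that J_{1,N}(ε^{16}) = 0, i.e. that there are no Jacobi forms of weight one and index N with character ε^{16}.) -/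
noncomputable section

/-- `ℚ/ℤ` as the additive circle of circumference 1. -/
abbrev QZ : Type := AddCircle (1 : ℚ)

lemma expPeriodic : Function.Periodic
    (fun q : ℚ => Complex.exp (2 * Real.pi * Complex.I * (q : ℂ))) 1 := by
  intro x
  push_cast
  rw [mul_add, Complex.exp_add, mul_one, Complex.exp_two_pi_mul_I, mul_one]

/-- The standard character `e : ℚ/ℤ → ℂ`, `e(t) = exp(2πi t)`. -/
def ee : QZ → ℂ := expPeriodic.lift

variable {M : Type} [AddCommGroup M]

/-- The bilinear form associated to a quadratic form `Q : M → ℚ/ℤ`. -/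
def Bf (Q : M → QZ) (x y : M) : QZ := Q (x + y) - Q x - Q y

/-- The Gauss sum `σ(M) = |M|^{-1/2} ∑_{x ∈ M} e(-Q(x))`. -/
def gaussSigma (Q : M → QZ) : ℂ :=
  ((Real.sqrt (Nat.card M) : ℂ))⁻¹ * ∑ᶠ x : M, ee (-(Q x))

/-- The operator `T_M` of the Weil representation: `(T_M λ)(x) = e(Q(x))·λ(x)`. -/
def Tweil (Q : M → QZ) (lam : M → ℂ) : M → ℂ := fun x => ee (Q x) * lam x

/-- The operator `S_M` of the Weil representation:
`(S_M λ)(y) = σ(M)·|M|^{-1/2}·∑_{x∈M} e(-B(y,x))·λ(x)`. -/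
def Sweil (Q : M → QZ) (lam : M → ℂ) : M → ℂ := fun y =>
  gaussSigma Q * ((Real.sqrt (Nat.card M) : ℂ))⁻¹ *
    ∑ᶠ x : M, ee (-(Bf Q y x)) * lam x

/-- The `p`-primary component of an abelian group, as a subgroup. -/
def primaryComp (M : Type) [AddCommGroup M] (p : ℕ) : AddSubgroup M where
  carrier := {x | ∃ k : ℕ, (p ^ k : ℕ) • x = 0}
  zero_mem' := ⟨0, smul_zero _⟩
  add_mem' := by
    rintro a b ⟨k, hk⟩ ⟨l, hl⟩
    refine ⟨k + l, ?_⟩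
    have ha : (p ^ (k + l) : ℕ) • a = 0 := by
      rw [pow_add, mul_comm, mul_smul, hk, smul_zero]
    have hb : (p ^ (k + l) : ℕ) • b = 0 := by
      rw [pow_add, mul_smul, hl, smul_zero]
    rw [smul_add, ha, hb, add_zero]
  neg_mem' := by
    rintro a ⟨k, hk⟩
    exact ⟨k, by rw [smul_neg, hk, neg_zero]⟩

end


lemma ee_coe (q : ℚ) : ee (q : QZ) = Complex.exp (2 * Real.pi * Complex.I * (q : ℂ)) := rfl

lemma ee_eq_one {t : QZ} (h : ee t = 1) : t = 0 := by
  induction t using QuotientAddGroup.induction_on with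
  | H q =>
    have h' : Complex.exp (2 * Real.pi * Complex.I * (q : ℂ)) = 1 := h
    rw [Complex.exp_eq_one_iff] at h'
    obtain ⟨n, hn⟩ := h'
    have h2 : (2 * Real.pi * Complex.I : ℂ) ≠ 0 := Complex.two_pi_I_ne_zero
    have h3 : (q : ℂ) = n := by
      apply mul_left_cancel₀ h2
      rw [hn]; ring
    have h4 : q = n := by exact_mod_cast h3
    change ((q : ℚ) : QZ) = 0
    rw [h4, AddCircle.coe_eq_zero_iff]
    exact ⟨n, by simp⟩

lemma key_abs {M : Type} [AddCommGroup M] (Q : M → QZ) (lam : M → ℂ)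
    (hT : Tweil Q lam = lam) (hS : Sweil Q lam = lam) (d : M)
    (hB : ∀ x y, Bf Q (x + d) y = Bf Q x y + Bf Q d y)
    (h1 : ∀ x, Q x = 0 → Bf Q d x = 0) (h2 : Q d ≠ 0) : lam = 0 := by
  have hsupp : ∀ x, lam x ≠ 0 → Q x = 0 := by
    intro x hx
    apply ee_eq_one
    have := congrFun hT x
    unfold Tweil at this
    exact mul_right_cancel₀ hx (by rw [this, one_mul])
  have htr : ∀ y, lam (y + d) = lam y := by
    intro y
    rw [← hS]
    unfold Sweil
    congr 1
    apply finsum_congr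
    intro x
    by_cases hx : lam x = 0
    · simp [hx]
    · rw [hB, h1 x (hsupp x hx), add_zero]
  by_contra hne
  obtain ⟨y, hy⟩ := Function.ne_iff.mp hne
  have hy' : lam y ≠ 0 := hy
  have e1 := hsupp y hy'
  have e2 := hsupp (y + d) (by rw [htr]; exact hy')
  have e3 := h1 y e1
  unfold Bf at e3
  rw [add_comm d y, e2, e1] at e3
  apply h2
  simpa using e3

lemma QZ_eq_zero_iff (q : ℚ) : ((q : ℚ) : QZ) = 0 ↔ ∃ n : ℤ, q = n := by
  rw [AddCircle.coe_eq_zero_iff]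
  constructor
  · rintro ⟨n, hn⟩; exact ⟨n, by rw [← hn]; simp⟩
  · rintro ⟨n, hn⟩; exact ⟨n, by rw [hn]; simp⟩

lemma QZ_eq_iff (q r : ℚ) : ((q : ℚ) : QZ) = (r : QZ) ↔ ∃ n : ℤ, q - r = n := by
  rw [← QZ_eq_zero_iff, AddCircle.coe_sub, sub_eq_zero]

lemma val_cast_ex (m : ℕ) [NeZero m] (a : ℤ) : ∃ k : ℤ, (((a : ZMod m).val : ℤ)) = a + m * k := by
  have : (((a : ZMod m).val : ℤ)) = a % m := ZMod.val_intCast a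
  exact ⟨-(a / m), by rw [this, Int.emod_def]; ring⟩

lemma key_int (N l : ℕ) (hN : 0 < N) (hl : 0 < l)
    (Q : ZMod (2 * l) × ZMod (2 * N) × ZMod 3 → QZ)
    (hQ : ∀ p : ZMod (2 * l) × ZMod (2 * N) × ZMod 3,
      Q p = -((((p.1.val : ℚ) ^ 2 / (4 * l) + (p.2.1.val : ℚ) ^ 2 / (4 * N)
        + (p.2.2.val : ℚ) ^ 2 / 3 : ℚ) : QZ)))
    (lam : ZMod (2 * l) × ZMod (2 * N) × ZMod 3 → ℂ)
    (hT : Tweil Q lam = lam) (hS : Sweil Q lam = lam) (d1 d2 d3 : ℤ)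
    (h1 : ∀ x y z : ℤ, (12 * l * N : ℤ) ∣ 3 * N * x ^ 2 + 3 * l * y ^ 2 + 4 * l * N * z ^ 2 →
      (6 * l * N : ℤ) ∣ 3 * N * d1 * x + 3 * l * d2 * y + 4 * l * N * d3 * z)
    (h2 : ¬ (12 * l * N : ℤ) ∣ 3 * N * d1 ^ 2 + 3 * l * d2 ^ 2 + 4 * l * N * d3 ^ 2) :
    lam = 0 := by
  have hN0 : (N : ℚ) ≠ 0 := by positivity
  have hl0 : (l : ℚ) ≠ 0 := by positivity
  have : NeZero (2 * l) := ⟨by omega⟩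
  have : NeZero (2 * N) := ⟨by omega⟩
  have hQi : ∀ a b c : ℤ, Q ((a : ZMod (2 * l)), (b : ZMod (2 * N)), (c : ZMod 3)) =
      ((-((a : ℚ) ^ 2 / (4 * l) + (b : ℚ) ^ 2 / (4 * N) + (c : ℚ) ^ 2 / 3) : ℚ) : QZ) := by
    intro a b c
    rw [hQ, ← AddCircle.coe_neg, QZ_eq_iff]
    obtain ⟨i, hi⟩ := val_cast_ex (2 * l) a
    obtain ⟨j, hj⟩ := val_cast_ex (2 * N) b
    obtain ⟨k, hk⟩ := val_cast_ex 3 c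
    have hi' : (((a : ZMod (2 * l)).val : ℚ)) = a + (2 * l : ℚ) * i := by exact_mod_cast hi
    have hj' : (((b : ZMod (2 * N)).val : ℚ)) = b + (2 * N : ℚ) * j := by exact_mod_cast hj
    have hk' : (((c : ZMod 3).val : ℚ)) = c + (3 : ℚ) * k := by exact_mod_cast hk
    refine ⟨-(a * i + l * i ^ 2 + b * j + N * j ^ 2 + 2 * c * k + 3 * k ^ 2), ?_⟩
    simp only
    rw [hi', hj', hk']
    push_cast
    field_simp
    ring
  have hBi : ∀ a b c a' b' c' : ℤ, Bf Q ((a : ZMod (2 * l)), (b : ZMod (2 * N)), (c : ZMod 3))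
      ((a' : ZMod (2 * l)), (b' : ZMod (2 * N)), (c' : ZMod 3)) =
      ((-((a * a' : ℚ) / (2 * l) + (b * b' : ℚ) / (2 * N) + 2 * (c * c' : ℚ) / 3) : ℚ) : QZ) := by
    intro a b c a' b' c'
    unfold Bf
    have : (((a : ZMod (2 * l)), (b : ZMod (2 * N)), (c : ZMod 3)) : ZMod (2 * l) × ZMod (2 * N) × ZMod 3) +
      ((a' : ZMod (2 * l)), (b' : ZMod (2 * N)), (c' : ZMod 3)) =
      (((a + a' : ℤ) : ZMod (2 * l)), ((b + b' : ℤ) : ZMod (2 * N)), ((c + c' : ℤ) : ZMod 3)) := by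
      simp
    rw [this, hQi, hQi, hQi, ← AddCircle.coe_sub, ← AddCircle.coe_sub]
    congr 1
    push_cast
    field_simp
    ring
  have hex : ∀ p : ZMod (2 * l) × ZMod (2 * N) × ZMod 3, ∃ a b c : ℤ,
      p = ((a : ZMod (2 * l)), (b : ZMod (2 * N)), (c : ZMod 3)) := by
    rintro ⟨p, q, r⟩
    obtain ⟨a, rfl⟩ := ZMod.intCast_surjective p
    obtain ⟨b, rfl⟩ := ZMod.intCast_surjective q
    obtain ⟨c, rfl⟩ := ZMod.intCast_surjective r
    exact ⟨a, b, c, rfl⟩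
  have hQ0 : ∀ a b c : ℤ, Q ((a : ZMod (2 * l)), (b : ZMod (2 * N)), (c : ZMod 3)) = 0 ↔
      (12 * l * N : ℤ) ∣ 3 * N * a ^ 2 + 3 * l * b ^ 2 + 4 * l * N * c ^ 2 := by
    intro a b c
    rw [hQi, QZ_eq_zero_iff]
    constructor
    · rintro ⟨n, hn⟩
      refine ⟨-n, ?_⟩
      have : (3 * N * a ^ 2 + 3 * l * b ^ 2 + 4 * l * N * c ^ 2 : ℚ) = 12 * l * N * (-n) := by
        rw [← hn]; field_simp; ring
      exact_mod_cast this
    · rintro ⟨n, hn⟩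
      refine ⟨-n, ?_⟩
      have : (3 * N * a ^ 2 + 3 * l * b ^ 2 + 4 * l * N * c ^ 2 : ℚ) = 12 * l * N * n := by
        exact_mod_cast hn
      push_cast
      field_simp
      linarith
  refine key_abs Q lam hT hS ((d1 : ZMod (2 * l)), (d2 : ZMod (2 * N)), (d3 : ZMod 3)) ?_ ?_ ?_
  · intro p q
    obtain ⟨a, b, c, rfl⟩ := hex p
    obtain ⟨a', b', c', rfl⟩ := hex q
    have : (((a : ZMod (2 * l)), (b : ZMod (2 * N)), (c : ZMod 3)) : ZMod (2 * l) × ZMod (2 * N) × ZMod 3) +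
      ((d1 : ZMod (2 * l)), (d2 : ZMod (2 * N)), (d3 : ZMod 3)) =
      (((a + d1 : ℤ) : ZMod (2 * l)), ((b + d2 : ℤ) : ZMod (2 * N)), ((c + d3 : ℤ) : ZMod 3)) := by
      simp
    rw [this, hBi, hBi, hBi, ← AddCircle.coe_add]
    congr 1
    push_cast
    field_simp
    ring
  · intro p hp
    obtain ⟨a, b, c, rfl⟩ := hex p
    rw [hQ0] at hp
    obtain ⟨n, hn⟩ := h1 a b c hp
    rw [hBi, QZ_eq_zero_iff]
    refine ⟨-n, ?_⟩
    have : (3 * N * d1 * a + 3 * l * d2 * b + 4 * l * N * d3 * c : ℚ) = 6 * l * N * n := by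
      exact_mod_cast hn
    push_cast
    field_simp
    linarith
  · rw [Ne, hQ0]; exact h2

def IsoV (l N x y z : ℤ) : Prop :=
  12 * l * N ∣ 3 * N * x ^ 2 + 3 * l * y ^ 2 + 4 * l * N * z ^ 2

def Good (l N : ℤ) : Prop := ∃ d1 d2 d3 : ℤ,
  (∀ x y z : ℤ, IsoV l N x y z →
      6 * l * N ∣ 3 * N * d1 * x + 3 * l * d2 * y + 4 * l * N * d3 * z) ∧
  ¬ IsoV l N d1 d2 d3

lemma good_x (l N d : ℤ) (hN : N ≠ 0)
    (h1 : ∀ x y z, IsoV l N x y z → 2 * l ∣ d * x) (h2 : ¬ 4 * l ∣ d ^ 2) : Good l N := by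
  refine ⟨d, 0, 0, ?_, ?_⟩
  · intro x y z h
    obtain ⟨c, hc⟩ := h1 x y z h
    exact ⟨c, by linear_combination 3 * N * hc⟩
  · rintro ⟨c, hc⟩
    apply h2
    refine ⟨c, ?_⟩
    have : (3 * N) * d ^ 2 = (3 * N) * (4 * l * c) := by linear_combination hc
    exact mul_left_cancel₀ (by simpa using hN) this

lemma isoV_swap {l N x y z : ℤ} (h : IsoV l N x y z) : IsoV N l y x z := by
  obtain ⟨c, hc⟩ := h
  exact ⟨c, by linear_combination hc⟩

lemma good_swap {l N : ℤ} (h : Good l N) : Good N l := by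
  obtain ⟨d1, d2, d3, h1, h2⟩ := h
  refine ⟨d2, d1, d3, ?_, fun h => h2 (isoV_swap h)⟩
  intro x y z h
  obtain ⟨c, hc⟩ := h1 y x z (isoV_swap h)
  exact ⟨c, by linear_combination hc⟩

lemma good_z (l N : ℤ) (hl : l ≠ 0) (hN : N ≠ 0)
    (h1 : ∀ x y z, IsoV l N x y z → 3 ∣ z) : Good l N := by
  refine ⟨0, 0, 1, ?_, ?_⟩
  · intro x y z h
    obtain ⟨c, hc⟩ := h1 x y z h
    exact ⟨2 * c, by rw [hc]; ring⟩
  · rintro ⟨c, hc⟩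
    have : (4 * l * N) * 1 = (4 * l * N) * (3 * c) := by linear_combination hc
    have := mul_left_cancel₀ (by simp [hl, hN]) this
    omega

lemma good_pow (N p u : ℤ) (j : ℕ) (hp : p ≠ 0) (hu : u ≠ 0) (hN : N ≠ 0) (hpu : ¬ p ∣ u)
    (h1 : ∀ x y z, IsoV (p ^ (2 * j + 1) * u) N x y z → p ^ (j + 1) ∣ x) :
    Good (p ^ (2 * j + 1) * u) N := by
  apply good_x _ _ (2 * u * p ^ j) hN
  · intro x y z h
    obtain ⟨c, hc⟩ := h1 x y z h
    exact ⟨c, by rw [hc]; ring⟩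
  · rintro ⟨c, hc⟩
    apply hpu
    refine ⟨c, ?_⟩
    have : (4 * u * p ^ (2 * j)) * u = (4 * u * p ^ (2 * j)) * (p * c) := by
      linear_combination hc
    exact mul_left_cancel₀ (by simp [hp, hu]) this

/-- descent for `u y² + p w x²` -/
lemma desc1 (p : ℤ) (hp : Prime p) (j : ℕ) : ∀ u w x y : ℤ, ¬ p ∣ u → ¬ p ∣ w →
    (p ^ (2 * j + 1) ∣ u * y ^ 2 + p * w * x ^ 2 → p ^ (j + 1) ∣ y) ∧
    (p ^ (2 * j + 2) ∣ u * y ^ 2 + p * w * x ^ 2 → p ^ (j + 1) ∣ x) := by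
  have base : ∀ (e : ℕ) (u w x y : ℤ), ¬ p ∣ u → p ^ (e + 1) ∣ u * y ^ 2 + p * w * x ^ 2 →
      ∃ y', y = p * y' ∧ p ^ e ∣ w * x ^ 2 + p * u * y' ^ 2 := by
    intro e u w x y hu h
    have h1 : p ∣ u * y ^ 2 := by
      have := (dvd_pow_self p (Nat.succ_ne_zero e)).trans h
      exact (dvd_add_left ⟨w * x ^ 2, by ring⟩).mp this
    obtain ⟨y', rfl⟩ := hp.dvd_of_dvd_pow ((hp.dvd_or_dvd h1).resolve_left hu)
    refine ⟨y', rfl, ?_⟩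
    obtain ⟨c, hc⟩ := h
    refine ⟨c, mul_left_cancel₀ hp.ne_zero ?_⟩
    linear_combination hc
  induction j with
  | zero =>
    intro u w x y hu hw
    constructor
    · intro h
      obtain ⟨y', rfl, -⟩ := base 0 u w x y hu h
      simp
    · intro h
      obtain ⟨y', rfl, h'⟩ := base 1 u w x y hu h
      obtain ⟨x', rfl, -⟩ := base 0 w u y' x hw h'
      simp
  | succ j ih =>
    intro u w x y hu hw
    have P : ∀ u w x y : ℤ, ¬ p ∣ u → ¬ p ∣ w →
      p ^ (2 * (j + 1) + 1) ∣ u * y ^ 2 + p * w * x ^ 2 → p ^ (j + 1 + 1) ∣ y := by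
      intro u w x y hu hw h
      obtain ⟨y', rfl, h'⟩ := base (2 * j + 2) u w x y hu h
      obtain ⟨c, hc⟩ := (ih w u y' x hw hu).2 h'
      exact ⟨c, by rw [hc]; ring⟩
    refine ⟨P u w x y hu hw, ?_⟩
    intro h
    obtain ⟨y', rfl, h'⟩ := base (2 * (j + 1) + 1) u w x y hu h
    exact P w u y' x hw hu h'

/-- descent for an anisotropic form -/
lemma desc2 (p c : ℤ) (hp0 : p ≠ 0) (j e : ℕ)
    (han : ∀ x y : ℤ, p ^ (e + 1) ∣ x ^ 2 + c * y ^ 2 → p ∣ x ∧ p ∣ y) : ∀ x y : ℤ,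
    p ^ (2 * j + (e + 1)) ∣ x ^ 2 + c * y ^ 2 → p ^ (j + 1) ∣ x ∧ p ^ (j + 1) ∣ y := by
  induction j with
  | zero => intro x y h; simpa using han x y (by simpa using h)
  | succ j ih =>
    intro x y h
    obtain ⟨⟨x', rfl⟩, ⟨y', rfl⟩⟩ := han x y ((pow_dvd_pow p (by omega)).trans h)
    obtain ⟨t, ht⟩ := h
    obtain ⟨⟨a, ha⟩, ⟨b, hb⟩⟩ := ih x' y' ⟨t, mul_left_cancel₀ (pow_ne_zero 2 hp0) (by
      linear_combination ht)⟩
    exact ⟨⟨a, by rw [ha]; ring⟩, ⟨b, by rw [hb]; ring⟩⟩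

lemma desc3 (c : ℤ) (hc : c % 3 = 1) (k : ℕ) : ∀ x y z : ℤ,
    3 ^ (k + 1) ∣ y ^ 2 + 3 * x ^ 2 + 3 ^ k * c * z ^ 2 → (3 : ℤ) ∣ z := by
  induction k with
  | zero =>
    intro x y z h
    have h' : (y ^ 2 + 3 * x ^ 2 + c * z ^ 2) % 3 = 0 := Int.emod_eq_zero_of_dvd (by simpa using h)
    rcases (by omega : z % 3 = 0 ∨ z % 3 = 1 ∨ z % 3 = 2) with hz | hz | hz <;>
    rcases (by omega : y % 3 = 0 ∨ y % 3 = 1 ∨ y % 3 = 2) with hy | hy | hy <;>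
    first
    | omega
    | (exfalso; revert h'; simp [pow_two, Int.add_emod, Int.mul_emod, hz, hy, hc])
  | succ k ih =>
    intro x y z h
    have h1 : (3 : ℤ) ∣ y ^ 2 := by
      have := (dvd_pow_self (3 : ℤ) (Nat.succ_ne_zero (k + 1))).trans h
      rw [add_assoc] at this
      exact (dvd_add_left ⟨x ^ 2 + 3 ^ k * c * z ^ 2, by ring⟩).mp this
    obtain ⟨y', rfl⟩ := Int.prime_three.dvd_of_dvd_pow h1
    obtain ⟨t, ht⟩ := h
    apply ih y' x z
    refine ⟨t, mul_left_cancel₀ (three_ne_zero) ?_⟩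
    linear_combination ht

lemma an_four (x y : ℤ) (h : (2 : ℤ) ^ (1 + 1) ∣ x ^ 2 + 1 * y ^ 2) : (2 : ℤ) ∣ x ∧ (2 : ℤ) ∣ y := by
  have h' : (x ^ 2 + y ^ 2) % 4 = 0 := Int.emod_eq_zero_of_dvd (by simpa using h)
  rcases (by omega : x % 4 = 0 ∨ x % 4 = 1 ∨ x % 4 = 2 ∨ x % 4 = 3) with hz | hz | hz | hz <;>
  rcases (by omega : y % 4 = 0 ∨ y % 4 = 1 ∨ y % 4 = 2 ∨ y % 4 = 3) with hy | hy | hy | hy <;>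
  first
  | omega
  | (exfalso; revert h'; simp [pow_two, Int.add_emod, Int.mul_emod, hz, hy])

lemma an_eight (x y : ℤ) (h : (2 : ℤ) ^ (2 + 1) ∣ x ^ 2 + 3 * y ^ 2) : (2 : ℤ) ∣ x ∧ (2 : ℤ) ∣ y := by
  have h' : (x ^ 2 + 3 * y ^ 2) % 8 = 0 := Int.emod_eq_zero_of_dvd (by simpa using h)
  have hx : x % 8 < 8 := by omega
  have hx0 : 0 ≤ x % 8 := by omega
  have hy : y % 8 < 8 := by omega
  have hy0 : 0 ≤ y % 8 := by omega
  have e : ((x % 8) ^ 2 + 3 * (y % 8) ^ 2) % 8 = 0 := by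
    rw [← h']; simp [pow_two, Int.add_emod, Int.mul_emod]
  suffices hh : x % 8 % 2 = 0 ∧ y % 8 % 2 = 0 by omega
  clear h h'
  generalize x % 8 = a at *
  generalize y % 8 = b at *
  interval_cases a <;> interval_cases b <;> simp_all

/-- `-3` is a nonresidue mod primes `p ≡ 2 mod 3`. -/
lemma an_p (p : ℕ) (hp : p.Prime) (hp3 : p % 3 = 2) (hp2 : p ≠ 2) (x y : ℤ)
    (h : (p : ℤ) ^ (0 + 1) ∣ x ^ 2 + 3 * y ^ 2) : (p : ℤ) ∣ x ∧ (p : ℤ) ∣ y := by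
  have := Fact.mk hp
  have h0 : (p : ℤ) ∣ x ^ 2 + 3 * y ^ 2 := by simpa using h
  have hy : (p : ℤ) ∣ y := by
    by_contra hy
    have hy' : (y : ZMod p) ≠ 0 := by rwa [Ne, ZMod.intCast_zmod_eq_zero_iff_dvd]
    have e : (x : ZMod p) ^ 2 + 3 * (y : ZMod p) ^ 2 = 0 := by
      have := (ZMod.intCast_zmod_eq_zero_iff_dvd _ p).mpr h0
      exact_mod_cast this
    have h2 : (2 : ZMod p) ≠ 0 := by
      intro h
      have : ((2 : ℕ) : ZMod p) = 0 := by exact_mod_cast h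
      rw [ZMod.natCast_eq_zero_iff] at this
      exact hp2 ((Nat.prime_dvd_prime_iff_eq hp Nat.prime_two).mp this)
    -- a cube root of unity
    set s : ZMod p := x / y with hs
    have hs2 : s ^ 2 = -3 := by
      rw [hs, div_pow, div_eq_iff (pow_ne_zero 2 hy')]
      linear_combination e
    set w : ZMod p := (s - 1) / 2 with hw
    have hw2 : 2 * w = s - 1 := by rw [hw]; field_simp
    have hww : w ^ 2 + w + 1 = 0 := by
      have : (2 * 2 : ZMod p) * (w ^ 2 + w + 1) = 0 := by
        have : (2 * 2 : ZMod p) * (w ^ 2 + w + 1) = (2 * w) ^ 2 + 2 * (2 * w) + 4 := by ring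
        rw [this, hw2]; linear_combination hs2
      exact (mul_eq_zero.mp this).resolve_left (mul_ne_zero h2 h2)
    have hw3 : w ^ 3 = 1 := by linear_combination (w - 1) * hww
    have hw0 : w ≠ 0 := by
      intro h; rw [h] at hw3; simp at hw3
    have hf := ZMod.pow_card_sub_one_eq_one hw0
    have hpm : p - 1 = 3 * (p / 3) + 1 := by omega
    rw [hpm, pow_succ, pow_mul, hw3, one_pow, one_mul] at hf
    rw [hf] at hww
    have : ((3 : ℕ) : ZMod p) = 0 := by push_cast; linear_combination hww
    rw [ZMod.natCast_eq_zero_iff] at this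
    have := (Nat.prime_dvd_prime_iff_eq hp Nat.prime_three).mp this
    omega
  refine ⟨?_, hy⟩
  have hp' : Prime (p : ℤ) := Nat.prime_iff_prime_int.mp hp
  apply hp'.dvd_of_dvd_pow (n := 2)
  exact (dvd_add_left (((hy.trans (dvd_pow_self y two_ne_zero))).mul_left 3)).mp h0

lemma split3 (m : ℕ) : 0 < m →
    (∃ p j u : ℕ, p.Prime ∧ p % 3 = 2 ∧ m = p ^ (2 * j + 1) * u ∧ ¬ p ∣ u) ∨
    ∃ a n : ℕ, m = 3 ^ a * n ∧ n % 3 = 1 := by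
  induction m using Nat.strong_induction_on with
  | _ m ih =>
    intro hm
    by_cases h1 : m = 1
    · right; exact ⟨0, 1, by simp [h1], rfl⟩
    have hp : m.minFac.Prime := Nat.minFac_prime h1
    have hpm := Nat.minFac_dvd m
    generalize m.minFac = p at hp hpm
    obtain ⟨e, u, hpu, hm'⟩ := Nat.exists_eq_pow_mul_and_not_dvd hm.ne' p hp.ne_one
    have he : e ≠ 0 := by
      rintro rfl
      apply hpu; rw [hm'] at hpm; simpa using hpm
    have hu : 0 < u := by
      rcases Nat.eq_zero_or_pos u with h | h
      · rw [h] at hpu; simp at hpu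
      · exact h
    have hlt : u < m := by
      rw [hm']
      exact lt_mul_of_one_lt_left hu (Nat.one_lt_pow he hp.one_lt)
    have hsq : p % 3 = 1 ∨ (p % 3 = 2 ∧ Even e) → p ^ e % 3 = 1 := by
      rintro (h | ⟨h, f, hf⟩)
      · rw [Nat.pow_mod, h]; simp
      · rw [hf, ← two_mul, pow_mul, Nat.pow_mod, Nat.pow_mod p, h]; simp
    rcases ih u hlt hu with ⟨q, j, v, hq, hq3, huv, hqv⟩ | ⟨a, n, hun, hn⟩
    · left
      refine ⟨q, j, p ^ e * v, hq, hq3, by rw [hm', huv]; ring, ?_⟩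
      intro h
      rcases (Nat.Prime.dvd_mul hq).mp h with h | h
      · have := (Nat.prime_dvd_prime_iff_eq hq hp).mp (hq.dvd_of_dvd_pow h)
        subst this
        apply hpu
        rw [huv]
        exact (dvd_pow_self q (Nat.succ_ne_zero _)).mul_right v
      · exact hqv h
    · rcases (by omega : p % 3 = 0 ∨ p % 3 = 1 ∨ p % 3 = 2) with h | h | h
      · have : p = 3 := ((Nat.prime_dvd_prime_iff_eq Nat.prime_three hp).mp
          (Nat.dvd_of_mod_eq_zero h)).symm
        right
        exact ⟨e + a, n, by rw [hm', hun, this]; ring, hn⟩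
      · right
        exact ⟨a, p ^ e * n, by rw [hm', hun]; ring, by rw [Nat.mul_mod, hn, hsq (Or.inl h)]⟩
      · rcases Nat.even_or_odd e with h' | ⟨f, hf⟩
        · right
          exact ⟨a, p ^ e * n, by rw [hm', hun]; ring,
            by rw [Nat.mul_mod, hn, hsq (Or.inr ⟨h, h'⟩)]⟩
        · left
          exact ⟨p, f, u, hp, h, by rw [hm', hf], hpu⟩

lemma an_all (p : ℕ) (hp : p.Prime) (hp3 : p % 3 = 2) (j : ℕ) (u x y : ℤ)
    (h : 4 * ((p : ℤ) ^ (2 * j + 1) * u) ∣ y ^ 2 + 3 * x ^ 2) : (p : ℤ) ^ (j + 1) ∣ x := by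
  by_cases hp2 : p = 2
  · subst hp2
    refine (desc2 2 3 two_ne_zero j 2 an_eight y x (Dvd.dvd.trans ⟨u, ?_⟩ h)).2
    push_cast; ring
  · refine (desc2 p 3 (by exact_mod_cast hp.ne_zero) j 0 (an_p p hp hp3 hp2) y x
      (Dvd.dvd.trans ⟨4 * u, ?_⟩ h)).2
    ring

/-- the case `N = 3 l` or `l = 3 N` -/
lemma good_three (m : ℕ) (hm : 0 < m) : Good (m : ℤ) (3 * m : ℤ) := by
  have hm0 : (m : ℤ) ≠ 0 := by exact_mod_cast hm.ne'
  have hiso : ∀ x y z : ℤ, IsoV (m : ℤ) (3 * m : ℤ) x y z →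
      12 * (m : ℤ) ∣ y ^ 2 + 3 * x ^ 2 + 4 * m * z ^ 2 := by
    rintro x y z ⟨c, hc⟩
    refine ⟨c, mul_left_cancel₀ (mul_ne_zero three_ne_zero hm0) ?_⟩
    linear_combination hc
  rcases split3 m hm with ⟨p, j, u, hp, hp3, hmu, hpu⟩ | ⟨a, n, hmn, hn⟩
  · have hu : (u : ℤ) ≠ 0 := by
      rintro h
      have : u = 0 := by exact_mod_cast h
      simp [this] at hpu
    have hmu' : (m : ℤ) = (p : ℤ) ^ (2 * j + 1) * u := by exact_mod_cast hmu
    have := good_pow (3 * m : ℤ) p u j (by exact_mod_cast hp.ne_zero) hu (by simpa using hm0)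
      (by exact_mod_cast hpu) ?_
    · rwa [← hmu'] at this
    · intro x y z h
      rw [← hmu'] at h
      obtain ⟨c, hc⟩ := hiso x y z h
      apply an_all p hp hp3 j u x y
      rw [← hmu']
      exact ⟨3 * c - z ^ 2, by linear_combination hc⟩
  · apply good_z _ _ hm0 (by simpa using hm0)
    intro x y z h
    have h' := hiso x y z h
    have hmn' : (m : ℤ) = 3 ^ a * n := by exact_mod_cast hmn
    apply desc3 (4 * n) (by omega) a x y z
    obtain ⟨c, hc⟩ := h'
    refine ⟨4 * n * c, ?_⟩
    rw [hmn'] at hc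
    linear_combination hc

lemma good_eq (m : ℕ) (hm : 0 < m) : Good (m : ℤ) (m : ℤ) := by
  have hm0 : (m : ℤ) ≠ 0 := by exact_mod_cast hm.ne'
  have hiso : ∀ x y z : ℤ, IsoV (m : ℤ) (m : ℤ) x y z →
      12 * (m : ℤ) ∣ 3 * (x ^ 2 + y ^ 2) + 4 * m * z ^ 2 := by
    rintro x y z ⟨c, hc⟩
    refine ⟨c, mul_left_cancel₀ hm0 ?_⟩
    linear_combination hc
  obtain ⟨e, u, hu2, hmu⟩ := Nat.exists_eq_pow_mul_and_not_dvd hm.ne' 2 (by norm_num)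
  have hu2' : ¬ (2 : ℤ) ∣ u := by exact_mod_cast hu2
  have hu : (u : ℤ) ≠ 0 := by
    rintro h
    simp [h] at hu2'
  have hmu' : (m : ℤ) = 2 ^ e * u := by exact_mod_cast hmu
  have hdiv : ∀ x y z : ℤ, IsoV (m : ℤ) (m : ℤ) x y z → (2 : ℤ) ^ (e + 2) ∣ x ^ 2 + 1 * y ^ 2 := by
    intro x y z h
    obtain ⟨c, hc⟩ := hiso x y z h
    have hco : IsCoprime ((2 : ℤ) ^ (e + 2)) 3 := IsCoprime.pow_left (by norm_num)
    apply hco.dvd_of_dvd_mul_left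
    refine ⟨u * (3 * c - z ^ 2), ?_⟩
    rw [hmu'] at hc
    linear_combination hc
  obtain ⟨j, hj⟩ := Nat.even_or_odd' e
  have hx : ∀ x y z : ℤ, IsoV (m : ℤ) (m : ℤ) x y z → (2 : ℤ) ^ (j + 1) ∣ x := by
    intro x y z h
    exact (desc2 2 1 two_ne_zero j 1 an_four x y
      ((pow_dvd_pow 2 (by omega)).trans (hdiv x y z h))).1
  rcases hj with hj | hj
  · apply good_x _ _ (u * 2 ^ j) hm0
    · intro x y z h
      obtain ⟨c, hc⟩ := hx x y z h
      exact ⟨c, by rw [hc, hmu', hj]; ring⟩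
    · rintro ⟨c, hc⟩
      apply hu2'
      refine ⟨2 * c, ?_⟩
      have : (u * 2 ^ (2 * j) : ℤ) * u = (u * 2 ^ (2 * j)) * (2 * (2 * c)) := by
        rw [hmu', hj] at hc
        linear_combination hc
      exact mul_left_cancel₀ (mul_ne_zero hu (pow_ne_zero _ two_ne_zero)) this
  · have := good_pow (m : ℤ) 2 u j two_ne_zero hu hm0 hu2' (by
      rw [← hj, ← hmu']; exact hx)
    rwa [← hj, ← hmu'] at this

/-- the case of different valuations at some `p ≠ 3` -/
lemma good_val (p u w k : ℕ) (hp : p.Prime) (hp3 : p ≠ 3) (hu : ¬ p ∣ u) (hw : ¬ p ∣ w) :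
    Good ((p : ℤ) ^ k * u) ((p : ℤ) ^ (k + 1) * w) := by
  have hp' : Prime (p : ℤ) := Nat.prime_iff_prime_int.mp hp
  have hp0 := hp'.ne_zero
  have hu' : ¬ (p : ℤ) ∣ u := by exact_mod_cast hu
  have hw' : ¬ (p : ℤ) ∣ w := by exact_mod_cast hw
  have hu0 : (u : ℤ) ≠ 0 := by rintro h; simp [h] at hu'
  have hw0 : (w : ℤ) ≠ 0 := by rintro h; simp [h] at hw'
  have hdiv : ∀ x y z, IsoV ((p : ℤ) ^ k * u) ((p : ℤ) ^ (k + 1) * w) x y z →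
      (p : ℤ) ^ (k + 1) ∣ u * y ^ 2 + p * w * x ^ 2 := by
    rintro x y z ⟨c, hc⟩
    have hco : IsCoprime ((p : ℤ) ^ (k + 1)) 3 := by
      apply IsCoprime.pow_left
      have := (Nat.coprime_primes hp Nat.prime_three).mpr hp3
      exact_mod_cast Nat.isCoprime_iff_coprime.mpr this
    apply hco.dvd_of_dvd_mul_left
    refine ⟨u * w * (12 * c - 4 * z ^ 2), mul_left_cancel₀ (pow_ne_zero k hp0) ?_⟩
    linear_combination hc
  obtain ⟨j, hj | hj⟩ := Nat.even_or_odd' k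
  · apply good_swap
    rw [hj]
    apply good_pow _ _ _ _ hp0 hw0 (mul_ne_zero (pow_ne_zero _ hp0) hu0) hw'
    intro y x z h
    rw [← hj] at h
    have := hdiv x y z (isoV_swap h)
    rw [hj] at this
    exact (desc1 p hp' j u w x y hu' hw').1 this
  · rw [hj]
    apply good_pow _ _ _ _ hp0 hu0 (mul_ne_zero (pow_ne_zero _ hp0) hw0) hu'
    intro x y z h
    rw [← hj] at h
    have := hdiv x y z h
    rw [hj] at this
    exact (desc1 p hp' j u w x y hu' hw').2 this

lemma good_main (N l : ℕ) (hN : 1 ≤ N) (hl : 0 < l)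
    (hdvd : l ∣ Nat.lcm 3 N) (hsf : Squarefree (Nat.lcm 3 N / l)) : Good (l : ℤ) (N : ℤ) := by
  obtain ⟨s, hs⟩ := hdvd
  rw [hs, Nat.mul_div_cancel_left _ hl] at hsf
  have hL : (3 ∣ N ∧ Nat.lcm 3 N = N) ∨ (¬ 3 ∣ N ∧ Nat.lcm 3 N = 3 * N) := by
    by_cases h : 3 ∣ N
    · exact Or.inl ⟨h, Nat.lcm_eq_right h⟩
    · exact Or.inr ⟨h, ((Nat.Prime.coprime_iff_not_dvd Nat.prime_three).mpr h).lcm_eq_mul⟩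
  by_cases hA : ∃ p, p.Prime ∧ p ≠ 3 ∧ p ∣ s
  · obtain ⟨p, hp, hp3, s', rfl⟩ := hA
    obtain ⟨k, u, hpu, rfl⟩ := Nat.exists_eq_pow_mul_and_not_dvd hl.ne' p hp.ne_one
    have hs' : ¬ p ∣ s' := by
      rintro ⟨t, rfl⟩
      have := hsf p ⟨t, by ring⟩
      exact hp.one_lt.ne' (Nat.isUnit_iff.mp this)
    have hus : ¬ p ∣ u * s' := by
      rw [hp.dvd_mul]; tauto
    have hw : ∃ w, N = p ^ (k + 1) * w ∧ ¬ p ∣ w := by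
      rcases hL with ⟨-, h⟩ | ⟨-, h⟩
      · exact ⟨u * s', by rw [← h, hs]; ring, hus⟩
      · have h3 : 3 * N = p ^ (k + 1) * (u * s') := by rw [← h, hs]; ring
        have hco : Nat.Coprime 3 (p ^ (k + 1)) :=
          Nat.Coprime.pow_right _ ((Nat.coprime_primes Nat.prime_three hp).mpr hp3.symm)
        obtain ⟨w, hw⟩ := hco.symm.dvd_of_dvd_mul_left ⟨_, h3⟩
        refine ⟨w, hw, ?_⟩
        intro hd
        apply hus
        have : u * s' = 3 * w := by
          apply Nat.eq_of_mul_eq_mul_left (pow_pos hp.pos (k + 1))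
          rw [← h3, hw]; ring
        rw [this]; exact hd.mul_left 3
    obtain ⟨w, rfl, hpw⟩ := hw
    push_cast
    exact good_val p u w k hp hp3 hpu hpw
  · push Not at hA
    have hs13 : s = 1 ∨ s = 3 := by
      by_cases h1 : s = 1
      · exact Or.inl h1
      right
      have h3 : 3 ∣ s := by
        by_contra h
        apply hA s.minFac (Nat.minFac_prime h1) _ (Nat.minFac_dvd s)
        intro e; apply h; rw [← e]; exact Nat.minFac_dvd s
      obtain ⟨t, rfl⟩ := h3
      by_cases ht : t = 1
      · rw [ht]
      exfalso
      have hq := Nat.minFac_prime ht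
      by_cases hq3 : t.minFac = 3
      · have : 3 ∣ t := hq3 ▸ Nat.minFac_dvd t
        obtain ⟨r, rfl⟩ := this
        have := hsf 3 ⟨r, by ring⟩
        simp at this
      · exact hA _ hq hq3 ((Nat.minFac_dvd t).mul_left 3)
    rcases hs13 with rfl | rfl <;> rcases hL with ⟨h3, h⟩ | ⟨h3, h⟩
    · have : l = N := by omega
      rw [this]; exact good_eq N hN
    · have : l = 3 * N := by omega
      rw [this]; push_cast; exact good_swap (good_three N hN)
    · have : N = 3 * l := by omega
      rw [this]; push_cast; exact good_three l hl
    · have : l = N := by omega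
      rw [this]; exact good_eq N hN

/-- vanishing of the invariants of the Weil representation of the
quadratic module `(ℤ/2l × ℤ/2N × ℤ/3, -x²/4l - y²/4N - z²/3)` for `l ∣ lcm(3,N)`
with `lcm(3,N)/l` squarefree; this is the representation-theoretic content of
`J_{1,N}(ε^{16}) = 0`. -/
theorem weight_one_eps16_vanishing (N l : ℕ) (hN : 1 ≤ N) (hl : 0 < l)
    (hdvd : l ∣ Nat.lcm 3 N) (hsf : Squarefree (Nat.lcm 3 N / l))
    (Q : ZMod (2 * l) × ZMod (2 * N) × ZMod 3 → QZ)
    (hQ : ∀ p : ZMod (2 * l) × ZMod (2 * N) × ZMod 3,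
      Q p = -((((p.1.val : ℚ) ^ 2 / (4 * l) + (p.2.1.val : ℚ) ^ 2 / (4 * N)
        + (p.2.2.val : ℚ) ^ 2 / 3 : ℚ) : QZ)))
    (lam : ZMod (2 * l) × ZMod (2 * N) × ZMod 3 → ℂ)
    (hT : Tweil Q lam = lam) (hS : Sweil Q lam = lam) : lam = 0 := by
  obtain ⟨d1, d2, d3, h1, h2⟩ := good_main N l hN hl hdvd hsf
  exact key_int N l hN hl Q hQ lam hT hS d1 d2 d3 h1 h2
end

section
/- Let (M,Q) be a nondegenerate finite quadratic module, U ≤ M an isotropic subgroup, and (U^⊥/U, Q̄) the quotient quadratic module. Define Φ : ℂ[U^⊥/U] → ℂ[M] by (Φλ)(y) = λ(y+U) if y ∈ U^⊥ and (Φλ)(y) = 0 otherwise (this is the map ⟨x+U⟩ ↦ Σ_{y∈x+U} ⟨y⟩). Then Φ is injective and intertwines the Weil representation operators: Φ ∘ T_{U^⊥/U} = T_M ∘ Φ and Φ ∘ S_{U^⊥/U} = S_M ∘ Φ. -/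
namespace QE

lemma ee_coe (q : ℚ) : ee (q : QZ) = Complex.exp (2 * Real.pi * Complex.I * (q : ℂ)) := rfl

lemma ee_add (a b : QZ) : ee (a + b) = ee a * ee b := by
  induction a using QuotientAddGroup.induction_on with
  | H a =>
  induction b using QuotientAddGroup.induction_on with
  | H b =>
  have h : ((a : QZ) + (b : QZ)) = ((a + b : ℚ) : QZ) := rfl
  rw [h, ee_coe, ee_coe, ee_coe, ← Complex.exp_add]
  push_cast
  rw [mul_add]

lemma ee_zero : ee 0 = 1 := by
  have h : (0 : QZ) = ((0 : ℚ) : QZ) := rfl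
  rw [h, ee_coe]
  simp

lemma ee_eq_one {a : QZ} (h : ee a = 1) : a = 0 := by
  induction a using QuotientAddGroup.induction_on with
  | H a =>
  rw [ee_coe, Complex.exp_eq_one_iff] at h
  obtain ⟨n, hn⟩ := h
  have h2 : (a : ℂ) = (n : ℂ) := by
    have := Complex.two_pi_I_ne_zero
    apply mul_left_cancel₀ this
    rw [hn]; ring
  have h3 : a = (n : ℚ) := by exact_mod_cast h2
  refine (AddCircle.coe_eq_zero_iff (1 : ℚ)).2 ⟨n, ?_⟩
  rw [h3]; simp

lemma sum_hom {G : Type} [AddCommGroup G] [Fintype G] (b : G → QZ)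
    (hb : ∀ x y, b (x + y) = b x + b y) (P : Prop) [Decidable P] (hP : P ↔ ∀ x, b x = 0) :
    ∑ x, ee (-(b x)) = if P then (Fintype.card G : ℂ) else 0 := by
  split_ifs with h
  · rw [hP] at h
    simp [h, ee_zero]
  · rw [hP] at h
    push Not at h
    obtain ⟨g, hg⟩ := h
    have h1 : ∑ x, ee (-(b x)) = ee (-(b g)) * ∑ x, ee (-(b x)) := by
      conv_lhs => rw [← Equiv.sum_comp (Equiv.addLeft g)]
      rw [Finset.mul_sum]
      refine Finset.sum_congr rfl fun x _ => ?_
      rw [← ee_add, Equiv.coe_addLeft, hb, neg_add]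
    by_contra hne
    have h2 : ee (-(b g)) = 1 := by
      apply mul_right_cancel₀ hne
      rw [← h1, one_mul]
    exact hg (neg_eq_zero.1 (ee_eq_one h2))

end QE

/-- for an isotropic subgroup `U` of a nondegenerate finite quadratic
module `(M,Q)` with dual `U^⊥` and quotient module `(U^⊥/U, Q̄)`, the map
`Φ : ℂ[U^⊥/U] → ℂ[M]`, `(Φλ)(y) = λ(y+U)` for `y ∈ U^⊥` and `0` otherwise, is
injective and intertwines the Weil representation operators. -/
theorem quotient_embedding {M : Type} [AddCommGroup M] [Finite M] (Q : M → QZ)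
    (hquad : ∀ (n : ℤ) (x : M), Q (n • x) = (n ^ 2 : ℤ) • Q x)
    (hbil : ∀ x x' y : M, Bf Q (x + x') y = Bf Q x y + Bf Q x' y)
    (hnd : ∀ x : M, (∀ y : M, Bf Q x y = 0) → x = 0)
    (U Up : AddSubgroup M) [DecidablePred (· ∈ Up)]
    (hiso : ∀ x ∈ U, Q x = 0)
    (hUp : ∀ y : M, y ∈ Up ↔ ∀ x ∈ U, Bf Q x y = 0)
    (Qbar : (Up ⧸ U.addSubgroupOf Up) → QZ)
    (hQbar : ∀ x : Up, Qbar (QuotientAddGroup.mk x) = Q x)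
    (Phi : ((Up ⧸ U.addSubgroupOf Up) → ℂ) → (M → ℂ))
    (hPhi : ∀ (lam : (Up ⧸ U.addSubgroupOf Up) → ℂ) (y : M),
      Phi lam y = if h : y ∈ Up then lam (QuotientAddGroup.mk (⟨y, h⟩ : Up)) else 0) :
    Function.Injective Phi ∧
    (∀ lam, Phi (Tweil Qbar lam) = Tweil Q (Phi lam)) ∧
    (∀ lam, Phi (Sweil Qbar lam) = Sweil Q (Phi lam)) := by
  classical
  have hsymm : ∀ x y, Bf Q x y = Bf Q y x := by
    intro x y
    unfold Bf
    rw [add_comm x y]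
    abel
  have hbil2 : ∀ y x x' : M, Bf Q y (x + x') = Bf Q y x + Bf Q y x' := by
    intro y x x'
    rw [hsymm, hbil, hsymm x, hsymm x']
  have hUUp : U ≤ Up := by
    intro y hy
    rw [hUp]
    intro x hx
    unfold Bf
    rw [hiso _ hx, hiso _ hy, hiso _ (U.add_mem hx hy)]
    simp
  have hPhi1 : ∀ lam (y : Up), Phi lam y = lam (QuotientAddGroup.mk y) := by
    intro lam y
    rw [hPhi, dif_pos y.2]
  have hPhi0 : ∀ lam (y : M), y ∉ Up → Phi lam y = 0 := by
    intro lam y hy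
    rw [hPhi, dif_neg hy]
  have hBbar : ∀ x y : Up, Bf Qbar (QuotientAddGroup.mk x) (QuotientAddGroup.mk y)
      = Bf Q (x : M) y := by
    intro x y
    unfold Bf
    rw [← QuotientAddGroup.mk_add, hQbar, hQbar, hQbar]
    rfl
  have hshift : ∀ lam (u : M), u ∈ U → ∀ x, Phi lam (u + x) = Phi lam x := by
    intro lam u hu x
    by_cases hx : x ∈ Up
    · have e1 := hPhi1 lam ⟨x, hx⟩
      have e2 := hPhi1 lam ⟨u + x, Up.add_mem (hUUp hu) hx⟩
      simp only at e1 e2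
      rw [e1, e2]
      congr 1
      refine (QuotientAddGroup.eq.2 ?_).symm
      rw [AddSubgroup.mem_addSubgroupOf]
      simpa using hu
    · rw [hPhi0 _ _ hx, hPhi0]
      rwa [AddSubgroup.add_mem_cancel_left _ (hUUp hu)]
  haveI : Fintype M := Fintype.ofFinite M
  have hsum : ∀ lam, ∑ x, Phi lam x = (Fintype.card U : ℂ) * ∑ q, lam q := by
    intro lam
    have e1 : ∑ x, Phi lam x = ∑ x : Up, lam (QuotientAddGroup.mk x) := by
      simp_rw [← hPhi1]
      rw [← Finset.sum_subtype (Finset.univ.filter (· ∈ Up)) (by simp) (Phi lam)]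
      refine (Finset.sum_filter_of_ne fun x _ hx => ?_).symm
      by_contra hn
      exact hx (hPhi0 _ _ hn)
    rw [e1, ← Finset.sum_fiberwise Finset.univ (fun x : Up => (QuotientAddGroup.mk x : Up ⧸ U.addSubgroupOf Up)), Finset.mul_sum]
    refine Finset.sum_congr rfl fun q _ => ?_
    rw [Finset.sum_congr rfl (g := fun _ => lam q), Finset.sum_const, nsmul_eq_mul]
    · congr 2
      have := Nat.card_congr (QuotientAddGroup.preimageMkEquivAddSubgroupProdSet (U.addSubgroupOf Up) {q})
      rw [Nat.card_prod] at this
      rw [Nat.card_congr (AddSubgroup.addSubgroupOfEquivOfLe hUUp).toEquiv] at this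
      simp only [Nat.card_eq_fintype_card, Fintype.card_unique, mul_one] at this
      rw [← this, ← Set.toFinset_card]
      congr 1
      ext x
      simp
    · intro x hx
      rw [(Finset.mem_filter.1 hx).2]
  have hU0 : (Fintype.card U : ℂ) ≠ 0 := by
    exact_mod_cast Fintype.card_ne_zero
  have hfU : ∀ x : M, ∑ u : U, ee (-(Bf Q x u)) = if x ∈ Up then (Fintype.card U : ℂ) else 0 := by
    intro x
    apply QE.sum_hom (fun u : U => Bf Q x u)
    · intro a b
      exact hbil2 _ _ _
    · rw [hUp]
      constructor
      · intro h u
        rw [hsymm]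
        exact h u u.2
      · intro h u hu
        rw [hsymm]
        exact h ⟨u, hu⟩
  have hfM : ∀ u : U, ∑ x : M, ee (-(Bf Q x u)) = if u = 0 then (Fintype.card M : ℂ) else 0 := by
    intro u
    apply QE.sum_hom (fun x : M => Bf Q x u)
    · intro a b
      exact hbil _ _ _
    · constructor
      · rintro rfl x
        have := hbil2 x 0 0
        simpa using this
      · intro h
        apply Subtype.ext
        apply hnd
        intro y
        rw [hsymm]
        exact h y
  have hcard0 : (Fintype.card M : ℂ) = ∑ x, Phi (fun _ => (Fintype.card U : ℂ)) x := by
    have h1 : ∑ u : U, ∑ x : M, ee (-(Bf Q x u)) = (Fintype.card M : ℂ) := by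
      simp_rw [hfM]
      simp
    rw [← h1, Finset.sum_comm]
    refine Finset.sum_congr rfl fun x _ => ?_
    rw [hfU, hPhi]
    split_ifs <;> rfl
  have hcard : (Fintype.card M : ℂ) = (Fintype.card U : ℂ) * ((Fintype.card U : ℂ) *
      (Fintype.card (Up ⧸ U.addSubgroupOf Up) : ℂ)) := by
    rw [hcard0, hsum]
    simp
    ring
  have hG : ∑ x, ee (-(Q x)) = (Fintype.card U : ℂ) * ∑ q, ee (-(Qbar q)) := by
    have h1 : ∀ u : U, ∑ x, ee (-(Q x)) = ∑ x, ee (-(Q x)) * ee (-(Bf Q x u)) := by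
      intro u
      conv_lhs => rw [← Equiv.sum_comp (Equiv.addRight (u : M))]
      refine Finset.sum_congr rfl fun x _ => ?_
      rw [← QE.ee_add, Equiv.coe_addRight]
      congr 1
      unfold Bf
      rw [hiso _ u.2]
      abel
    have h2 : (Fintype.card U : ℂ) * ∑ x, ee (-(Q x))
        = (Fintype.card U : ℂ) * ∑ x, Phi (fun q => ee (-(Qbar q))) x := by
      calc (Fintype.card U : ℂ) * ∑ x, ee (-(Q x)) = ∑ u : U, ∑ x, ee (-(Q x)) := by simp
        _ = ∑ u : U, ∑ x, ee (-(Q x)) * ee (-(Bf Q x u)) :=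
          Finset.sum_congr rfl fun u _ => h1 u
        _ = _ := by
          rw [Finset.sum_comm, Finset.mul_sum]
          refine Finset.sum_congr rfl fun x _ => ?_
          rw [← Finset.mul_sum, hfU, hPhi]
          split_ifs with h
          · rw [hQbar, mul_comm]
          · simp
    rw [mul_left_cancel₀ hU0 h2, hsum]
  have hsq : ∀ n : ℕ, ((Real.sqrt (n : ℝ) : ℂ))⁻¹ * ((Real.sqrt (n : ℝ) : ℂ))⁻¹ = (n : ℂ)⁻¹ := by
    intro n
    rw [← mul_inv, ← Complex.ofReal_mul, Real.mul_self_sqrt (Nat.cast_nonneg n)]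
    simp
  refine ⟨?_, ?_, ?_⟩
  · intro a b hab
    funext q
    induction q using QuotientAddGroup.induction_on with
    | H x => exact (hPhi1 a x).symm.trans ((congrFun hab x).trans (hPhi1 b x))
  · intro lam
    funext y
    unfold Tweil
    rw [hPhi, hPhi]
    split_ifs with h
    · rw [hQbar]
    · simp
  · intro lam
    funext y
    by_cases hy : y ∈ Up
    · have e := hPhi1 (Sweil Qbar lam) ⟨y, hy⟩
      simp only at e
      rw [e]
      unfold Sweil gaussSigma
      simp only [finsum_eq_sum_of_fintype, Nat.card_eq_fintype_card]
      have h3 : ∑ x, ee (-(Bf Q y x)) * Phi lam x = (Fintype.card U : ℂ) *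
          ∑ q, ee (-(Bf Qbar (QuotientAddGroup.mk ⟨y, hy⟩) q)) * lam q := by
        rw [← hsum]
        refine Finset.sum_congr rfl fun x _ => ?_
        rw [hPhi, hPhi]
        split_ifs with h
        · rw [hBbar]
        · simp
      rw [h3, hG]
      have hA := hsq (Fintype.card M)
      have hB := hsq (Fintype.card (Up ⧸ U.addSubgroupOf Up))
      have hC : (Fintype.card (Up ⧸ U.addSubgroupOf Up) : ℂ)⁻¹
          = (Fintype.card M : ℂ)⁻¹ * ((Fintype.card U : ℂ) * (Fintype.card U : ℂ)) := by
        rw [hcard]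
        have : (Fintype.card (Up ⧸ U.addSubgroupOf Up) : ℂ) ≠ 0 := by
          exact_mod_cast Fintype.card_ne_zero
        field_simp
      rw [hC, ← hA] at hB
      generalize ∑ q, ee (-(Bf Qbar (QuotientAddGroup.mk ⟨y, hy⟩) q)) * lam q = X
      generalize ∑ q, ee (-(Qbar q)) = Y
      linear_combination (X * Y) * hB
    · rw [hPhi0 _ _ hy]
      unfold Sweil
      simp only [finsum_eq_sum_of_fintype]
      have hy2 := hy
      rw [hUp] at hy2
      push Not at hy2
      obtain ⟨u, hu, hne⟩ := hy2
      have h1 : ∑ x, ee (-(Bf Q y x)) * Phi lam x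
          = ee (-(Bf Q y u)) * ∑ x, ee (-(Bf Q y x)) * Phi lam x := by
        conv_lhs => rw [← Equiv.sum_comp (Equiv.addLeft u)]
        rw [Finset.mul_sum]
        refine Finset.sum_congr rfl fun x _ => ?_
        rw [Equiv.coe_addLeft, hshift _ _ hu, hbil2, neg_add, QE.ee_add, mul_assoc]
      have h0 : ∑ x, ee (-(Bf Q y x)) * Phi lam x = 0 := by
        by_contra hn
        have h2 : ee (-(Bf Q y u)) = 1 := by
          apply mul_right_cancel₀ hn
          rw [← h1, one_mul]
        apply hne
        rw [hsymm]
        exact neg_eq_zero.1 (QE.ee_eq_one h2)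
      rw [h0, mul_zero]
end
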